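/- Let 𝒫 be compactness and let n ≥ 1 be a natural number. Then the Euclidean space ℝⁿ is 𝒫-connected if and only if n ≥ 2. -/

import Mathlib

open Set Topology
open scoped unitInterval

universe u

/-- A zero-set of a topological space: the preimage of `{0}` under some continuous
function into `[0,1]`. -/
def IsZeroSetIn {X : Type u} [TopologicalSpace X] (Z : Set X) : Prop :=
  ∃ f : X → I, Continuous f ∧ Z = f ⁻¹' {0}

/-- A cozero-set: the complement of a zero-set. -/
def IsCozeroSetIn {X : Type u} [TopologicalSpace X] (C : Set X) : Prop :=
  IsZeroSetIn Cᶜ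

/-- A `P`-separation of `X`: disjoint cozero-sets `C`, `D` whose closures both fail `P`,
such that `X \ (C ∪ D)` is contained in a cozero-set whose closure has `P`. -/
def IsPSeparation (P : (Y : Type u) → [TopologicalSpace Y] → Prop)
    {X : Type u} [TopologicalSpace X] (C D : Set X) : Prop :=
  IsCozeroSetIn C ∧ IsCozeroSetIn D ∧ Disjoint C D ∧
    ¬ P ↥(closure C) ∧ ¬ P ↥(closure D) ∧
    ∃ E : Set X, IsCozeroSetIn E ∧ P ↥(closure E) ∧ (C ∪ D)ᶜ ⊆ E

/-- `X` is `P`-connected if it admits no `P`-separation. -/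
def PConnected (P : (Y : Type u) → [TopologicalSpace Y] → Prop)
    (X : Type u) [TopologicalSpace X] : Prop :=
  ¬ ∃ C D : Set X, IsPSeparation P C D

/-- `P` is closed hereditary. -/
def ClosedHereditary (P : (Y : Type u) → [TopologicalSpace Y] → Prop) : Prop :=
  ∀ (Y : Type u) [TopologicalSpace Y] (A : Set Y), IsClosed A → P Y → P ↥A

/-- `P` is preserved under finite sums of closed subspaces. -/
def PreservedByFiniteClosedSums (P : (Y : Type u) → [TopologicalSpace Y] → Prop) : Prop :=
  ∀ (Y : Type u) [TopologicalSpace Y] (n : ℕ) (A : Fin n → Set Y),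
    (∀ i, IsClosed (A i)) → (∀ i, P ↥(A i)) → (⋃ i, A i) = Set.univ → P Y

/-- `λ_P X ⊆ βX`. -/
def lambdaSet (P : (Y : Type u) → [TopologicalSpace Y] → Prop)
    (X : Type u) [TopologicalSpace X] : Set (StoneCech X) :=
  ⋃ C ∈ {C : Set X | IsCozeroSetIn C ∧ P ↥(closure C)},
    interior (closure (stoneCechUnit '' C))

/-- `Ex_X U = βX \ cl_βX (X \ U)`. -/
def ExSet {X : Type u} [TopologicalSpace X] (U : Set X) : Set (StoneCech X) :=
  (closure (stoneCechUnit '' Uᶜ))ᶜ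

/-- The Hewitt realcompactification `υX`, realized inside `βX`. -/
def upsilonSet (X : Type u) [TopologicalSpace X] : Set (StoneCech X) :=
  {p | ∀ Z : Set (StoneCech X), IsZeroSetIn Z → p ∈ Z →
    (Z ∩ Set.range (stoneCechUnit : X → StoneCech X)).Nonempty}

/-- A space is pseudocompact if every continuous real-valued function on it is bounded. -/
def Pseudocompact (Y : Type u) [TopologicalSpace Y] : Prop :=
  ∀ f : Y → ℝ, Continuous f → ∃ M : ℝ, ∀ y, |f y| ≤ M

/-- A perfect map: continuous, closed, with compact fibers. -/
def IsPerfectMap {X Y : Type u} [TopologicalSpace X] [TopologicalSpace Y] (f : X → Y) : Prop :=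
  Continuous f ∧ IsClosedMap f ∧ ∀ y : Y, IsCompact (f ⁻¹' {y})

theorem IsCozeroSetIn.isOpen {X : Type u} [TopologicalSpace X] {C : Set X}
    (h : IsCozeroSetIn C) : IsOpen C := by
  obtain ⟨f, hf, hC⟩ := h
  rw [← isClosed_compl_iff, hC]
  exact isClosed_singleton.preimage hf

theorem isCozeroSetIn_setOf_pos {X : Type u} [TopologicalSpace X] {g : X → ℝ}
    (hg : Continuous g) : IsCozeroSetIn {x | 0 < g x} := by
  refine ⟨fun x => projIcc 0 1 zero_le_one (g x), continuous_projIcc.comp hg, ?_⟩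
  ext x
  simp

theorem isPreconnected_compl_closedBall_of_one_lt_rank {E : Type*} [NormedAddCommGroup E]
    [NormedSpace ℝ E] (h : 1 < Module.rank ℝ E) {r : ℝ} (hr : 0 ≤ r) :
    IsPreconnected (Metric.closedBall (0 : E) r)ᶜ := by
  have himage : (fun x : E => (1 + r / ‖x‖) • x) '' {0}ᶜ = (Metric.closedBall (0 : E) r)ᶜ := by
    ext y
    simp only [mem_image, mem_compl_iff, mem_singleton_iff, mem_closedBall_zero_iff, not_le]
    constructor
    · rintro ⟨x, hx, rfl⟩
      have hx' : 0 < ‖x‖ := norm_pos_iff.mpr hx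
      rw [norm_smul, Real.norm_of_nonneg (by positivity), add_mul, div_mul_cancel₀ _ hx'.ne']
      linarith
    · intro hy
      have hy' : 0 < ‖y‖ := hr.trans_lt hy
      have hpos : 0 < 1 - r / ‖y‖ := by
        rw [sub_pos, div_lt_one hy']
        exact hy
      have hsub : ‖y‖ - r ≠ 0 := (sub_pos.mpr hy).ne'
      refine ⟨(1 - r / ‖y‖) • y, smul_ne_zero hpos.ne' (norm_pos_iff.mp hy'), ?_⟩
      rw [norm_smul, Real.norm_of_nonneg hpos.le, smul_smul, sub_mul,
        div_mul_cancel₀ _ hy'.ne', one_mul]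
      convert one_smul ℝ y using 2
      field_simp
      ring
  rw [← himage]
  refine (isConnected_compl_singleton_of_one_lt_rank h 0).isPreconnected.image _ ?_
  refine (continuousOn_const.add (continuousOn_const.div continuous_norm.continuousOn ?_)).smul
    continuousOn_id
  exact fun x hx => norm_ne_zero_iff.mpr hx

theorem pConnected_compactSpace_of_one_lt_rank {E : Type*} [NormedAddCommGroup E]
    [NormedSpace ℝ E] [ProperSpace E] (h : 1 < Module.rank ℝ E) :
    PConnected (fun Y _ => CompactSpace Y) E := by
  rintro ⟨C, D, hC, hD, hdisj, hCc, hDc, U, -, hUc, hsub⟩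
  have compact_closure_of_disjoint {r : ℝ} {S T : Set E} (hST : Disjoint S T)
      (hS : (Metric.closedBall (0 : E) r)ᶜ ⊆ S) : CompactSpace (closure T) := by
    rw [← isCompact_iff_compactSpace]
    refine (isCompact_closedBall (0 : E) r).of_isClosed_subset isClosed_closure
      (closure_minimal ?_ Metric.isClosed_closedBall)
    exact hST.symm.subset_compl_right.trans (compl_subset_comm.mp hS)
  rw [← isCompact_iff_compactSpace] at hUc
  obtain ⟨r, hr, hUr⟩ := hUc.isBounded.subset_closedBall_lt 0 0
  have hcover : (Metric.closedBall (0 : E) r)ᶜ ⊆ C ∪ D :=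
    compl_subset_comm.mp (hsub.trans (subset_closure.trans hUr))
  rcases (isPreconnected_compl_closedBall_of_one_lt_rank h hr.le).subset_or_subset
    hC.isOpen hD.isOpen hdisj hcover with hball | hball
  · exact hDc (compact_closure_of_disjoint hdisj hball)
  · exact hCc (compact_closure_of_disjoint hdisj.symm hball)

theorem not_compactSpace_closure_setOf_pos {E : Type*} [NormedAddCommGroup E] [NormedSpace ℝ E]
    (f : E →L[ℝ] ℝ) (hf : f ≠ 0) : ¬ CompactSpace (closure {x | 0 < f x}) := by
  rw [← isCompact_iff_compactSpace]
  intro hc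
  obtain ⟨M, hM⟩ := (hc.image f.continuous).bddAbove
  obtain ⟨x, hx⟩ := f.toLinearMap.surjective (by exact_mod_cast hf) (max M 0 + 1)
  replace hx : f x = max M 0 + 1 := hx
  have hpos : 0 < f x := hx ▸ by positivity
  have := hM (mem_image_of_mem f (subset_closure hpos))
  linarith [le_max_left M 0]

theorem not_pConnected_compactSpace_euclideanSpace_one :
    ¬ PConnected (fun Y _ => CompactSpace Y) (EuclideanSpace ℝ (Fin 1)) := by
  let f : EuclideanSpace ℝ (Fin 1) →L[ℝ] ℝ := EuclideanSpace.proj 0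
  have hf : f ≠ 0 := fun h => by
    simpa [f] using DFunLike.congr_fun h (EuclideanSpace.single 0 1)
  refine not_not.mpr ⟨{x | 0 < f x}, {x | 0 < (-f) x}, isCozeroSetIn_setOf_pos f.continuous,
    isCozeroSetIn_setOf_pos (-f).continuous, ?_, not_compactSpace_closure_setOf_pos f hf,
    not_compactSpace_closure_setOf_pos (-f) (neg_ne_zero.mpr hf),
    {x | 0 < 1 - ‖x‖}, isCozeroSetIn_setOf_pos (by fun_prop), ?_, ?_⟩
  · refine disjoint_left.mpr fun x hx hx' => ?_
    simp only [mem_ofPred_eq, neg_apply] at hx hx'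
    linarith
  · refine isCompact_iff_compactSpace.mp ?_
    refine (isCompact_closedBall 0 1).of_isClosed_subset isClosed_closure
      (closure_minimal (fun x hx => ?_) Metric.isClosed_closedBall)
    simpa using (sub_pos.mp hx).le
  · intro x hx
    simp only [mem_compl_iff, mem_union, mem_ofPred_eq, neg_apply, not_or,
      not_lt] at hx
    have hx0 : x = 0 := by
      ext i
      rw [Subsingleton.elim i 0]
      exact le_antisymm hx.1 (by linarith [hx.2] : 0 ≤ f x)
    simp [hx0]

/-- With `𝒫` = compactness, `ℝⁿ` is `𝒫`-connected iff `n ≥ 2`. -/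
theorem euclideanSpace_compactness_connected_iff (n : ℕ) (hn : 1 ≤ n) :
    PConnected (fun Y _ => CompactSpace Y) (EuclideanSpace ℝ (Fin n)) ↔ 2 ≤ n := by
  constructor
  · intro h
    by_contra hlt
    obtain rfl : n = 1 := by omega
    exact not_pConnected_compactSpace_euclideanSpace_one h
  · intro h
    apply pConnected_compactSpace_of_one_lt_rank
    rw [← Module.finrank_eq_rank, finrank_euclideanSpace_fin]
    exact_mod_cast h
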